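/- Fix x ∈ ℝ^N and n ∈ ℝ^M, and for an M×N real matrix H write y = y(H) = Hx + n. Define Ğ(H, x, n) = ‖u_{x|y}(y)‖₂², where u_{x|y}(y) = (Σ_{k,l} p_k q_l f^{kl}(y) u_{x|y}^{kl}(y)) / (Σ_{k,l} p_k q_l f^{kl}(y)). Then H ↦ Ğ(H, x, n) is differentiable and its gradient equals (Σ_{k,l,r,s} h^{klrs} w_{klrs}) / (Σ_{k,l,r,s} h^{klrs}), where h^{klrs} = p_k q_l p_r q_s f^{kl}(y) f^{rs}(y), z^{klrs} = (u_{x|y}^{kl}(y))ᵀ u_{x|y}^{rs}(y), and w_{klrs} = −(R^{kl} + R^{rs}) z^{klrs} + (D^{klrs} + D^{rskl}) + 2 z^{klrs} (Σ_{k',l'} p_{k'} q_{l'} f^{k'l'}(y) R^{k'l'}) / (Σ_{k',l'} p_{k'} q_{l'} f^{k'l'}(y)). -/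

import Mathlib

open Matrix MeasureTheory ProbabilityTheory
open scoped NNReal ENNReal Classical

attribute [local instance] Matrix.normedAddCommGroup Matrix.normedSpace

/-- The Gaussian density `N(u, C)` evaluated at `t`:
`(2π)^(−M/2) det(C)^(−1/2) exp(−(1/2)(t−u)ᵀ C⁻¹ (t−u))`. -/
noncomputable def gaussianPdf {M : ℕ} (u : Fin M → ℝ)
    (C : Matrix (Fin M) (Fin M) ℝ) (t : Fin M → ℝ) : ℝ :=
  (2 * Real.pi) ^ (-(M : ℝ) / 2) * C.det ^ (-(1 : ℝ) / 2) *
    Real.exp (-(1 / 2) * ((t - u) ⬝ᵥ C⁻¹ *ᵥ (t - u)))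

/-- `Cyy(H) = H Cx Hᵀ + Cn`. -/
def Cyy {M N : ℕ} (Cx : Matrix (Fin N) (Fin N) ℝ) (Cn : Matrix (Fin M) (Fin M) ℝ)
    (H : Matrix (Fin M) (Fin N) ℝ) : Matrix (Fin M) (Fin M) ℝ :=
  H * Cx * Hᵀ + Cn

/-- `w(H) = y(H) − u_y(H) = (H x + n) − (H ux + un)`. -/
def wVec {M N : ℕ} (ux : Fin N → ℝ) (un : Fin M → ℝ)
    (H : Matrix (Fin M) (Fin N) ℝ) (x : Fin N → ℝ) (n : Fin M → ℝ) : Fin M → ℝ :=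
  (H *ᵥ x + n) - (H *ᵥ ux + un)

/-- The matrix `R(H) = Cyy⁻¹ w (x − ux)ᵀ + Cyy⁻¹ (I − w wᵀ Cyy⁻¹) H Cx`. -/
noncomputable def Rmat {M N : ℕ} (ux : Fin N → ℝ) (Cx : Matrix (Fin N) (Fin N) ℝ)
    (un : Fin M → ℝ) (Cn : Matrix (Fin M) (Fin M) ℝ)
    (H : Matrix (Fin M) (Fin N) ℝ) (x : Fin N → ℝ) (n : Fin M → ℝ) :
    Matrix (Fin M) (Fin N) ℝ :=
  vecMulVec ((Cyy Cx Cn H)⁻¹ *ᵥ wVec ux un H x n) (x - ux) +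
    (Cyy Cx Cn H)⁻¹ *
      (1 - vecMulVec (wVec ux un H x n) (wVec ux un H x n) * (Cyy Cx Cn H)⁻¹) * (H * Cx)

/-- The component-wise linear estimate along the sample path:
`u_{x|y}(H) = ux + Cx Hᵀ Cyy(H)⁻¹ w(H)`, evaluated at `y(H) = H x + n`. -/
noncomputable def uxyP {M N : ℕ} (ux : Fin N → ℝ) (Cx : Matrix (Fin N) (Fin N) ℝ)
    (un : Fin M → ℝ) (Cn : Matrix (Fin M) (Fin M) ℝ)
    (H : Matrix (Fin M) (Fin N) ℝ) (x : Fin N → ℝ) (n : Fin M → ℝ) : Fin N → ℝ :=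
  ux + (Cx * Hᵀ) *ᵥ (Cyy Cx Cn H)⁻¹ *ᵥ wVec ux un H x n

/-- The matrix `C^{klrs} = (Cyy^{kl})⁻¹ w^{kl} (u_{x|y}^{rs})ᵀ Cx^k Hᵀ (Cyy^{kl})⁻¹`, where the
first four arguments describe the `(k,l)` component and the next four the `(r,s)` component. -/
noncomputable def Cmat {M N : ℕ}
    (ux₁ : Fin N → ℝ) (Cx₁ : Matrix (Fin N) (Fin N) ℝ)
    (un₁ : Fin M → ℝ) (Cn₁ : Matrix (Fin M) (Fin M) ℝ)
    (ux₂ : Fin N → ℝ) (Cx₂ : Matrix (Fin N) (Fin N) ℝ)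
    (un₂ : Fin M → ℝ) (Cn₂ : Matrix (Fin M) (Fin M) ℝ)
    (H : Matrix (Fin M) (Fin N) ℝ) (x : Fin N → ℝ) (n : Fin M → ℝ) :
    Matrix (Fin M) (Fin M) ℝ :=
  vecMulVec ((Cyy Cx₁ Cn₁ H)⁻¹ *ᵥ wVec ux₁ un₁ H x n)
    ((Cx₁ * Hᵀ * (Cyy Cx₁ Cn₁ H)⁻¹)ᵀ *ᵥ uxyP ux₂ Cx₂ un₂ Cn₂ H x n)

/-- The matrix `D^{klrs} = (Cyy^{kl})⁻¹ w^{kl} (u_{x|y}^{rs})ᵀ Cx^k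
− (C^{klrs} + (C^{klrs})ᵀ) H Cx^k + (Cyy^{kl})⁻¹ H Cx^k u_{x|y}^{rs} (x − ux^k)ᵀ`. -/
noncomputable def Dmat {M N : ℕ}
    (ux₁ : Fin N → ℝ) (Cx₁ : Matrix (Fin N) (Fin N) ℝ)
    (un₁ : Fin M → ℝ) (Cn₁ : Matrix (Fin M) (Fin M) ℝ)
    (ux₂ : Fin N → ℝ) (Cx₂ : Matrix (Fin N) (Fin N) ℝ)
    (un₂ : Fin M → ℝ) (Cn₂ : Matrix (Fin M) (Fin M) ℝ)
    (H : Matrix (Fin M) (Fin N) ℝ) (x : Fin N → ℝ) (n : Fin M → ℝ) :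
    Matrix (Fin M) (Fin N) ℝ :=
  vecMulVec ((Cyy Cx₁ Cn₁ H)⁻¹ *ᵥ wVec ux₁ un₁ H x n)
      (Cx₁ᵀ *ᵥ uxyP ux₂ Cx₂ un₂ Cn₂ H x n)
    - (Cmat ux₁ Cx₁ un₁ Cn₁ ux₂ Cx₂ un₂ Cn₂ H x n +
        (Cmat ux₁ Cx₁ un₁ Cn₁ ux₂ Cx₂ un₂ Cn₂ H x n)ᵀ) * (H * Cx₁)
    + vecMulVec (((Cyy Cx₁ Cn₁ H)⁻¹ * H * Cx₁) *ᵥ uxyP ux₂ Cx₂ un₂ Cn₂ H x n) (x - ux₁)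

/-- Component Gaussian density along the sample path: `f^{kl}(y(H))` with `y(H) = H x + n`. -/
noncomputable def fComp {M N : ℕ} (ux : Fin N → ℝ) (Cx : Matrix (Fin N) (Fin N) ℝ)
    (un : Fin M → ℝ) (Cn : Matrix (Fin M) (Fin M) ℝ)
    (H : Matrix (Fin M) (Fin N) ℝ) (x : Fin N → ℝ) (n : Fin M → ℝ) : ℝ :=
  gaussianPdf (H *ᵥ ux + un) (Cyy Cx Cn H) (H *ᵥ x + n)

/-- The mixture density along the sample path: `f(y(H)) = ∑ k l, p k q l f^{kl}(y(H))`. -/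
noncomputable def mixDen {M N : ℕ} {K L : Type*} [Fintype K] [Fintype L]
    (p : K → ℝ≥0) (q : L → ℝ≥0)
    (ux : K → Fin N → ℝ) (Cx : K → Matrix (Fin N) (Fin N) ℝ)
    (un : L → Fin M → ℝ) (Cn : L → Matrix (Fin M) (Fin M) ℝ)
    (H : Matrix (Fin M) (Fin N) ℝ) (x : Fin N → ℝ) (n : Fin M → ℝ) : ℝ :=
  ∑ k, ∑ l, (p k : ℝ) * (q l : ℝ) * fComp (ux k) (Cx k) (un l) (Cn l) H x n

/-- The MMSE estimate along the sample path:
`u_{x|y}(y(H)) = (∑ k l, p k q l f^{kl} u_{x|y}^{kl}) / (∑ k l, p k q l f^{kl})`. -/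
noncomputable def uxyMix {M N : ℕ} {K L : Type*} [Fintype K] [Fintype L]
    (p : K → ℝ≥0) (q : L → ℝ≥0)
    (ux : K → Fin N → ℝ) (Cx : K → Matrix (Fin N) (Fin N) ℝ)
    (un : L → Fin M → ℝ) (Cn : L → Matrix (Fin M) (Fin M) ℝ)
    (H : Matrix (Fin M) (Fin N) ℝ) (x : Fin N → ℝ) (n : Fin M → ℝ) : Fin N → ℝ :=
  (mixDen p q ux Cx un Cn H x n)⁻¹ •
    ∑ k, ∑ l, ((p k : ℝ) * (q l : ℝ) * fComp (ux k) (Cx k) (un l) (Cn l) H x n) •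
      uxyP (ux k) (Cx k) (un l) (Cn l) H x n

/-- `Ğ(H, x, n) = ‖u_{x|y}(y(H))‖₂²`, the squared Euclidean norm of the MMSE estimate. -/
noncomputable def Gbreve {M N : ℕ} {K L : Type*} [Fintype K] [Fintype L]
    (p : K → ℝ≥0) (q : L → ℝ≥0)
    (ux : K → Fin N → ℝ) (Cx : K → Matrix (Fin N) (Fin N) ℝ)
    (un : L → Fin M → ℝ) (Cn : L → Matrix (Fin M) (Fin M) ℝ)
    (H : Matrix (Fin M) (Fin N) ℝ) (x : Fin N → ℝ) (n : Fin M → ℝ) : ℝ :=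
  uxyMix p q ux Cx un Cn H x n ⬝ᵥ uxyMix p q ux Cx un Cn H x n

/-- `h^{klrs} = p k q l p r q s f^{kl}(y) f^{rs}(y)`. -/
noncomputable def hCoef {M N : ℕ} {K L : Type*} [Fintype K] [Fintype L]
    (p : K → ℝ≥0) (q : L → ℝ≥0)
    (ux : K → Fin N → ℝ) (Cx : K → Matrix (Fin N) (Fin N) ℝ)
    (un : L → Fin M → ℝ) (Cn : L → Matrix (Fin M) (Fin M) ℝ)
    (H : Matrix (Fin M) (Fin N) ℝ) (x : Fin N → ℝ) (n : Fin M → ℝ)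
    (k : K) (l : L) (r : K) (s : L) : ℝ :=
  (p k : ℝ) * (q l : ℝ) * (p r : ℝ) * (q s : ℝ) *
    fComp (ux k) (Cx k) (un l) (Cn l) H x n * fComp (ux r) (Cx r) (un s) (Cn s) H x n

/-- `z^{klrs} = (u_{x|y}^{kl})ᵀ u_{x|y}^{rs}` along the sample path. -/
noncomputable def zCoef {M N : ℕ} {K L : Type*}
    (ux : K → Fin N → ℝ) (Cx : K → Matrix (Fin N) (Fin N) ℝ)
    (un : L → Fin M → ℝ) (Cn : L → Matrix (Fin M) (Fin M) ℝ)
    (H : Matrix (Fin M) (Fin N) ℝ) (x : Fin N → ℝ) (n : Fin M → ℝ)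
    (k : K) (l : L) (r : K) (s : L) : ℝ :=
  uxyP (ux k) (Cx k) (un l) (Cn l) H x n ⬝ᵥ uxyP (ux r) (Cx r) (un s) (Cn s) H x n

/-- The matrix `w_{klrs} = −(R^{kl} + R^{rs}) z^{klrs} + (D^{klrs} + D^{rskl})
+ 2 z^{klrs} (∑ k' l', p k' q l' f^{k'l'} R^{k'l'}) / (∑ k' l', p k' q l' f^{k'l'})`. -/
noncomputable def wMat {M N : ℕ} {K L : Type*} [Fintype K] [Fintype L]
    (p : K → ℝ≥0) (q : L → ℝ≥0)
    (ux : K → Fin N → ℝ) (Cx : K → Matrix (Fin N) (Fin N) ℝ)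
    (un : L → Fin M → ℝ) (Cn : L → Matrix (Fin M) (Fin M) ℝ)
    (H : Matrix (Fin M) (Fin N) ℝ) (x : Fin N → ℝ) (n : Fin M → ℝ)
    (k : K) (l : L) (r : K) (s : L) : Matrix (Fin M) (Fin N) ℝ :=
  (-(zCoef ux Cx un Cn H x n k l r s)) •
      (Rmat (ux k) (Cx k) (un l) (Cn l) H x n + Rmat (ux r) (Cx r) (un s) (Cn s) H x n)
    + (Dmat (ux k) (Cx k) (un l) (Cn l) (ux r) (Cx r) (un s) (Cn s) H x n +
        Dmat (ux r) (Cx r) (un s) (Cn s) (ux k) (Cx k) (un l) (Cn l) H x n)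
    + (2 * zCoef ux Cx un Cn H x n k l r s / mixDen p q ux Cx un Cn H x n) •
        ∑ k', ∑ l', ((p k' : ℝ) * (q l' : ℝ) * fComp (ux k') (Cx k') (un l') (Cn l') H x n) •
          Rmat (ux k') (Cx k') (un l') (Cn l') H x n

/-- The gradient of `Ğ` w.r.t. `H`: `(∑ klrs, h^{klrs} w_{klrs}) / (∑ klrs, h^{klrs})`. -/
noncomputable def gradG {M N : ℕ} {K L : Type*} [Fintype K] [Fintype L]
    (p : K → ℝ≥0) (q : L → ℝ≥0)
    (ux : K → Fin N → ℝ) (Cx : K → Matrix (Fin N) (Fin N) ℝ)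
    (un : L → Fin M → ℝ) (Cn : L → Matrix (Fin M) (Fin M) ℝ)
    (H : Matrix (Fin M) (Fin N) ℝ) (x : Fin N → ℝ) (n : Fin M → ℝ) :
    Matrix (Fin M) (Fin N) ℝ :=
  (∑ k, ∑ l, ∑ r, ∑ s, hCoef p q ux Cx un Cn H x n k l r s)⁻¹ •
    ∑ k, ∑ l, ∑ r, ∑ s, hCoef p q ux Cx un Cn H x n k l r s • wMat p q ux Cx un Cn H x n k l r s

open scoped Topology

section Differential

variable {E : Type*} [NormedAddCommGroup E] [NormedSpace ℝ E]
  {V : Type*} [NormedAddCommGroup V] [NormedSpace ℝ V]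
  {ι m n o : Type*} [Fintype ι] [Fintype m] [Fintype n] [Fintype o] {x : E}

/-- `F` is Fréchet differentiable at `x`, with differential given pointwise by `D`. -/
def HasDifferentialAt (F : E → V) (D : E → V) (x : E) : Prop :=
  ∃ L : E →L[ℝ] V, HasFDerivAt F L x ∧ ∀ Δ, L Δ = D Δ

namespace HasDifferentialAt

theorem differentiableAt {F D : E → V} (h : HasDifferentialAt F D x) : DifferentiableAt ℝ F x :=
  h.choose_spec.1.differentiableAt

theorem unique {F D D' : E → V} (h : HasDifferentialAt F D x) (h' : HasDifferentialAt F D' x)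
    (Δ : E) : D Δ = D' Δ := by
  obtain ⟨L, hL, hD⟩ := h
  obtain ⟨L', hL', hD'⟩ := h'
  rw [← hD, ← hD', hL.unique hL']

theorem congr_differential {F D D' : E → V} (h : HasDifferentialAt F D x)
    (hD : ∀ Δ, D Δ = D' Δ) : HasDifferentialAt F D' x := by
  obtain ⟨L, hL, hLD⟩ := h
  exact ⟨L, hL, fun Δ => (hLD Δ).trans (hD Δ)⟩

theorem congr_of_eventuallyEq {F G D : E → V} (h : HasDifferentialAt F D x)
    (hG : G =ᶠ[𝓝 x] F) : HasDifferentialAt G D x := by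
  obtain ⟨L, hL, hLD⟩ := h
  exact ⟨L, hL.congr_of_eventuallyEq hG, hLD⟩

theorem const (c : V) : HasDifferentialAt (fun _ : E => c) (fun _ => 0) x :=
  ⟨0, hasFDerivAt_const c x, fun _ => rfl⟩

theorem id : HasDifferentialAt (fun y : E => y) (fun Δ => Δ) x :=
  ⟨.id ℝ E, hasFDerivAt_id x, fun _ => rfl⟩

theorem add {F G D D' : E → V} (hF : HasDifferentialAt F D x) (hG : HasDifferentialAt G D' x) :
    HasDifferentialAt (fun y => F y + G y) (fun Δ => D Δ + D' Δ) x := by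
  obtain ⟨L, hL, hD⟩ := hF
  obtain ⟨L', hL', hD'⟩ := hG
  exact ⟨L + L', hL.fun_add hL', fun Δ => by simp [hD, hD']⟩

theorem sub {F G D D' : E → V} (hF : HasDifferentialAt F D x) (hG : HasDifferentialAt G D' x) :
    HasDifferentialAt (fun y => F y - G y) (fun Δ => D Δ - D' Δ) x := by
  obtain ⟨L, hL, hD⟩ := hF
  obtain ⟨L', hL', hD'⟩ := hG
  exact ⟨L - L', hL.fun_sub hL', fun Δ => by simp [hD, hD']⟩

theorem sum {F D : ι → E → V} (h : ∀ i, HasDifferentialAt (F i) (D i) x) :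
    HasDifferentialAt (fun y => ∑ i, F i y) (fun Δ => ∑ i, D i Δ) x := by
  choose L hL hD using h
  exact ⟨∑ i, L i, HasFDerivAt.fun_sum fun i _ => hL i, fun Δ => by simp [hD]⟩

theorem mul {F G D D' : E → ℝ} (hF : HasDifferentialAt F D x) (hG : HasDifferentialAt G D' x) :
    HasDifferentialAt (fun y => F y * G y) (fun Δ => D Δ * G x + F x * D' Δ) x := by
  obtain ⟨L, hL, hD⟩ := hF
  obtain ⟨L', hL', hD'⟩ := hG
  exact ⟨_, hL.fun_mul hL', fun Δ => by simp [hD, hD']; ring⟩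

theorem const_mul {F D : E → ℝ} (c : ℝ) (hF : HasDifferentialAt F D x) :
    HasDifferentialAt (fun y => c * F y) (fun Δ => c * D Δ) x :=
  ((const c).mul hF).congr_differential fun Δ => by ring

theorem comp_hasDerivAt {F D : E → ℝ} {φ : ℝ → ℝ} {φ' : ℝ} (hF : HasDifferentialAt F D x)
    (hφ : HasDerivAt φ φ' (F x)) : HasDifferentialAt (fun y => φ (F y)) (fun Δ => φ' * D Δ) x := by
  obtain ⟨L, hL, hD⟩ := hF
  exact ⟨_, hφ.comp_hasFDerivAt x hL, fun Δ => by simp [hD]⟩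

theorem comp {W : Type*} [NormedAddCommGroup W] [NormedSpace ℝ W] {F D : E → V} {G D' : V → W}
    (hG : HasDifferentialAt G D' (F x)) (hF : HasDifferentialAt F D x) :
    HasDifferentialAt (fun y => G (F y)) (fun Δ => D' (D Δ)) x := by
  obtain ⟨L, hL, hD⟩ := hF
  obtain ⟨L', hL', hD'⟩ := hG
  exact ⟨_, hL'.comp x hL, fun Δ => by simp [hD, hD']⟩

theorem pi_iff {F D : E → ι → V} :
    HasDifferentialAt F D x ↔ ∀ i, HasDifferentialAt (fun y => F y i) (fun Δ => D Δ i) x := by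
  constructor
  · rintro ⟨L, hL, hD⟩ i
    exact ⟨_, hasFDerivAt_pi'.1 hL i, fun Δ => by simp [hD]⟩
  · intro h
    choose L hL hD using h
    exact ⟨.pi L, hasFDerivAt_pi.2 hL, fun Δ => by ext i; simp [hD]⟩

theorem matrix_iff {F D : E → Matrix m n ℝ} : HasDifferentialAt F D x ↔
    ∀ i j, HasDifferentialAt (fun y => F y i j) (fun Δ => D Δ i j) x :=
  (pi_iff (V := n → ℝ)).trans (forall_congr' fun _ => pi_iff)

theorem matrix_mul {A A' : E → Matrix m n ℝ} {B B' : E → Matrix n o ℝ}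
    (hA : HasDifferentialAt A A' x) (hB : HasDifferentialAt B B' x) :
    HasDifferentialAt (fun y => A y * B y) (fun Δ => A' Δ * B x + A x * B' Δ) x := by
  rw [matrix_iff] at *
  intro i j
  simp only [Matrix.add_apply, Matrix.mul_apply, ← Finset.sum_add_distrib]
  exact sum fun k => (hA i k).mul (hB k j)

theorem transpose {A A' : E → Matrix m n ℝ} (hA : HasDifferentialAt A A' x) :
    HasDifferentialAt (fun y => (A y)ᵀ) (fun Δ => (A' Δ)ᵀ) x := by
  rw [matrix_iff] at *
  exact fun i j => hA j i

theorem dotProduct {v v' w w' : E → n → ℝ}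
    (hv : HasDifferentialAt v v' x) (hw : HasDifferentialAt w w' x) :
    HasDifferentialAt (fun y => v y ⬝ᵥ w y) (fun Δ => v' Δ ⬝ᵥ w x + v x ⬝ᵥ w' Δ) x := by
  rw [pi_iff] at *
  simp only [_root_.dotProduct, ← Finset.sum_add_distrib]
  exact sum fun k => (hv k).mul (hw k)

theorem mulVec {A A' : E → Matrix m n ℝ} {v v' : E → n → ℝ}
    (hA : HasDifferentialAt A A' x) (hv : HasDifferentialAt v v' x) :
    HasDifferentialAt (fun y => A y *ᵥ v y) (fun Δ => A' Δ *ᵥ v x + A x *ᵥ v' Δ) x := by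
  rw [matrix_iff] at hA
  exact pi_iff.2 fun i => (pi_iff.2 (hA i)).dotProduct hv

end HasDifferentialAt

theorem DifferentiableAt.hasDifferentialAt {F : E → V} (h : DifferentiableAt ℝ F x) :
    HasDifferentialAt F (fderiv ℝ F x) x :=
  ⟨_, h.hasFDerivAt, fun _ => rfl⟩

theorem differentiableAt_matrix {F : E → Matrix m n ℝ} :
    DifferentiableAt ℝ F x ↔ ∀ i j, DifferentiableAt ℝ (fun y => F y i j) x := by
  refine ⟨fun h i j =>
    (HasDifferentialAt.matrix_iff.1 h.hasDifferentialAt i j).differentiableAt, fun h => ?_⟩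
  exact (HasDifferentialAt.matrix_iff (D := fun Δ => .of fun i j => fderiv ℝ (F · i j) x Δ).2
    fun i j => (h i j).hasDifferentialAt).differentiableAt

variable [DecidableEq n]

theorem DifferentiableAt.matrix_det {A : E → Matrix n n ℝ} (hA : DifferentiableAt ℝ A x) :
    DifferentiableAt ℝ (fun y => (A y).det) x := by
  rw [differentiableAt_matrix] at hA
  simp only [Matrix.det_apply']
  fun_prop

theorem DifferentiableAt.matrix_inv {A : E → Matrix n n ℝ} (hA : DifferentiableAt ℝ A x)
    (h0 : (A x).det ≠ 0) : DifferentiableAt ℝ (fun y => (A y)⁻¹) x := by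
  rw [differentiableAt_matrix]
  intro i j
  simp only [Matrix.inv_def, Matrix.smul_apply, Matrix.adjugate_apply, Ring.inverse_eq_inv',
    smul_eq_mul]
  refine (hA.matrix_det.fun_inv h0).fun_mul (DifferentiableAt.matrix_det ?_)
  rw [differentiableAt_matrix] at hA ⊢
  intro a b
  by_cases h : a = j
  · subst h; simp
  · simpa [Matrix.updateRow_ne h] using hA a b

/-- Jacobi's formula for the differential of the determinant. -/
theorem hasDifferentialAt_det {C : Matrix n n ℝ} (h0 : C.det ≠ 0) :
    HasDifferentialAt (fun A : Matrix n n ℝ => A.det) (fun B => C.det * (C⁻¹ * B).trace) C := by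
  refine (DifferentiableAt.matrix_det differentiableAt_id).hasDifferentialAt.congr_differential
    fun B => ?_
  refine ((DifferentiableAt.matrix_det (A := fun A : Matrix n n ℝ => A)
    differentiableAt_id).hasFDerivAt.hasLineDerivAt B).unique ?_
  obtain ⟨P, hP⟩ : ∃ P : Polynomial ℝ, ∀ t : ℝ,
      (C + t • B).det = C.det * (1 + t * ((C⁻¹ * B).trace + t * P.eval t)) := by
    refine ⟨(1 + (Polynomial.X : Polynomial ℝ) • (C⁻¹ * B).map Polynomial.C).det.divX.divX,
      fun t => ?_⟩
    have : C + t • B = C * (1 + t • (C⁻¹ * B)) := by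
      rw [mul_add, mul_one, mul_smul_comm, Matrix.mul_nonsing_inv_cancel_left _ _ h0.isUnit]
    rw [this, Matrix.det_mul, Matrix.det_one_add_smul]
    ring
  unfold HasLineDerivAt
  simp only [hP]
  have h1 := hasDerivAt_id (0 : ℝ)
  convert! ((h1.mul ((h1.mul (P.hasDerivAt 0)).const_add (C⁻¹ * B).trace)).const_add 1).const_mul
    C.det using 1
  simp

namespace HasDifferentialAt

theorem matrix_det {A A' : E → Matrix n n ℝ} (hA : HasDifferentialAt A A' x)
    (h0 : (A x).det ≠ 0) :
    HasDifferentialAt (fun y => (A y).det) (fun Δ => (A x).det * ((A x)⁻¹ * A' Δ).trace) x :=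
  (hasDifferentialAt_det h0).comp hA

theorem matrix_inv {A A' : E → Matrix n n ℝ} (hA : HasDifferentialAt A A' x)
    (h0 : (A x).det ≠ 0) :
    HasDifferentialAt (fun y => (A y)⁻¹) (fun Δ => -((A x)⁻¹ * A' Δ * (A x)⁻¹)) x := by
  have hinv := (hA.differentiableAt.matrix_inv h0).hasDifferentialAt
  have hone : HasDifferentialAt (fun y => A y * (A y)⁻¹) (fun _ => 0) x := by
    refine (const 1).congr_of_eventuallyEq ?_
    filter_upwards [hA.differentiableAt.matrix_det.continuousAt.eventually_ne h0] with y hy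
    exact Matrix.mul_nonsing_inv _ hy.isUnit
  refine hinv.congr_differential fun Δ => ?_
  have h := (hA.matrix_mul hinv).unique hone Δ
  have h' := congrArg ((A x)⁻¹ * ·) h
  simp only [mul_add, mul_zero, Matrix.nonsing_inv_mul_cancel_left _ _ h0.isUnit] at h'
  rw [Matrix.mul_assoc]
  exact eq_neg_of_add_eq_zero_right h'

end HasDifferentialAt

end Differential

section Trace

variable {m n : Type*} [Fintype m] [Fintype n]

theorem trace_vecMulVec_transpose_mul (a : m → ℝ) (b : n → ℝ) (B : Matrix m n ℝ) :
    ((vecMulVec a b)ᵀ * B).trace = a ⬝ᵥ B *ᵥ b := by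
  rw [transpose_vecMulVec, vecMulVec_mul, trace_vecMulVec, dotProduct_comm, ← dotProduct_mulVec]

end Trace

section Component

variable {M N : ℕ} {Cx : Matrix (Fin N) (Fin N) ℝ} {Cn : Matrix (Fin M) (Fin M) ℝ}
  (ux : Fin N → ℝ) (un : Fin M → ℝ) (H : Matrix (Fin M) (Fin N) ℝ)
  (x : Fin N → ℝ) (n : Fin M → ℝ)

theorem Cyy_posDef (hCx : Cx.PosSemidef) (hCn : Cn.PosDef) : (Cyy Cx Cn H).PosDef := by
  have := hCx.mul_mul_conjTranspose_same H
  rw [conjTranspose_eq_transpose_of_trivial] at this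
  rw [Cyy, add_comm]
  exact hCn.add_posSemidef this

theorem hasDifferentialAt_Cyy (Cx : Matrix (Fin N) (Fin N) ℝ) (Cn : Matrix (Fin M) (Fin M) ℝ) :
    HasDifferentialAt (Cyy Cx Cn) (fun Δ => Δ * Cx * Hᵀ + H * Cx * Δᵀ) H :=
  (((HasDifferentialAt.id.matrix_mul (.const Cx)).matrix_mul HasDifferentialAt.id.transpose).add
    (.const Cn)).congr_differential fun Δ => by simp

theorem hasDifferentialAt_wVec :
    HasDifferentialAt (fun H' => wVec ux un H' x n) (fun Δ => Δ *ᵥ (x - ux)) H :=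
  (((HasDifferentialAt.id.mulVec (.const x)).add (.const n)).sub
    ((HasDifferentialAt.id.mulVec (.const ux)).add (.const un))).congr_differential
      fun Δ => by simp [mulVec_sub]

theorem fComp_pos (hCx : Cx.PosSemidef) (hCn : Cn.PosDef) : 0 < fComp ux Cx un Cn H x n := by
  have := (Cyy_posDef H hCx hCn).det_pos
  unfold fComp gaussianPdf
  positivity

theorem trace_Rmat_transpose_mul (hCx : Cx.PosSemidef) (hCn : Cn.PosDef)
    (Δ : Matrix (Fin M) (Fin N) ℝ) :
    ((Rmat ux Cx un Cn H x n)ᵀ * Δ).trace =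
      1 / 2 * ((Cyy Cx Cn H)⁻¹ * (Δ * Cx * Hᵀ + H * Cx * Δᵀ)).trace +
      1 / 2 * (Δ *ᵥ (x - ux) ⬝ᵥ (Cyy Cx Cn H)⁻¹ *ᵥ wVec ux un H x n +
        wVec ux un H x n ⬝ᵥ
          (-((Cyy Cx Cn H)⁻¹ * (Δ * Cx * Hᵀ + H * Cx * Δᵀ) * (Cyy Cx Cn H)⁻¹) *ᵥ
              wVec ux un H x n + (Cyy Cx Cn H)⁻¹ *ᵥ Δ *ᵥ (x - ux))) := by
  have hS : ((Cyy Cx Cn H)⁻¹)ᵀ = (Cyy Cx Cn H)⁻¹ := (Cyy_posDef H hCx hCn).isHermitian.inv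
  have hX : Cxᵀ = Cx := hCx.isHermitian
  unfold Rmat
  generalize (Cyy Cx Cn H)⁻¹ = S at *
  generalize wVec ux un H x n = w
  generalize x - ux = d
  have hw (v : Fin M → ℝ) : w ⬝ᵥ S *ᵥ v = S *ᵥ w ⬝ᵥ v := by
    rw [dotProduct_mulVec, ← mulVec_transpose, hS]
  have h1 : (S * (Δ * Cx * Hᵀ)).trace = ((S * (H * Cx))ᵀ * Δ).trace := by
    simp only [transpose_mul, hS, hX]
    rw [trace_mul_comm S, trace_mul_comm _ Δ]
    simp only [Matrix.mul_assoc]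
  have h2 : (S * (H * Cx * Δᵀ)).trace = ((S * (H * Cx))ᵀ * Δ).trace := by
    rw [← trace_transpose ((S * (H * Cx))ᵀ * Δ), transpose_mul, transpose_transpose,
      trace_mul_comm Δᵀ]
    simp only [Matrix.mul_assoc]
  have h3 : S * (vecMulVec w w * S) * (H * Cx) = vecMulVec (S *ᵥ w) ((Cx * Hᵀ) *ᵥ S *ᵥ w) := by
    rw [vecMulVec_mul, mul_vecMulVec, vecMulVec_mul, ← mulVec_transpose, ← mulVec_transpose, hS,
      transpose_mul, hX]
  rw [Matrix.mul_sub, Matrix.mul_one, Matrix.sub_mul, h3]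
  simp only [transpose_add, transpose_sub, Matrix.add_mul, Matrix.sub_mul, trace_add, trace_sub,
    trace_vecMulVec_transpose_mul, Matrix.mul_add, h1, h2, neg_mulVec, add_mulVec, dotProduct_add,
    dotProduct_neg, ← mulVec_mulVec, hw]
  have h4 : S *ᵥ w ⬝ᵥ H *ᵥ Cx *ᵥ Δᵀ *ᵥ S *ᵥ w = S *ᵥ w ⬝ᵥ Δ *ᵥ Cx *ᵥ Hᵀ *ᵥ S *ᵥ w := by
    have := dotProduct_transpose_mulVec (Δ * Cx * Hᵀ) (S *ᵥ w) (S *ᵥ w)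
    simpa only [transpose_mul, hX, transpose_transpose, ← mulVec_mulVec] using this
  rw [h4, dotProduct_comm (Δ *ᵥ d)]
  ring

theorem hasDifferentialAt_fComp (hCx : Cx.PosSemidef) (hCn : Cn.PosDef) :
    HasDifferentialAt (fun H' => fComp ux Cx un Cn H' x n)
      (fun Δ => -(fComp ux Cx un Cn H x n * ((Rmat ux Cx un Cn H x n)ᵀ * Δ).trace)) H := by
  have hdet := (Cyy_posDef H hCx hCn).det_pos
  have hC := hasDifferentialAt_Cyy H Cx Cn
  have hw := hasDifferentialAt_wVec ux un H x n
  have hquad := hw.dotProduct ((hC.matrix_inv hdet.ne').mulVec hw)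
  have hpow := (hC.matrix_det hdet.ne').comp_hasDerivAt
    (Real.hasDerivAt_rpow_const (p := -(1 : ℝ) / 2) (.inl hdet.ne'))
  have h := (hpow.const_mul ((2 * Real.pi) ^ (-(M : ℝ) / 2))).mul
    ((hquad.const_mul (-(1 / 2))).comp_hasDerivAt (Real.hasDerivAt_exp _))
  refine h.congr_differential fun Δ => ?_
  rw [trace_Rmat_transpose_mul ux un H x n hCx hCn, Real.rpow_sub_one hdet.ne']
  change _ = -((2 * Real.pi) ^ (-(M : ℝ) / 2) * (Cyy Cx Cn H).det ^ (-(1 : ℝ) / 2) *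
    Real.exp (-(1 / 2) * (wVec ux un H x n ⬝ᵥ (Cyy Cx Cn H)⁻¹ *ᵥ wVec ux un H x n)) * _)
  field_simp
  ring

/-- The differential of `H ↦ u_{x|y}(H)`. -/
noncomputable def uxyPDifferential (Cx : Matrix (Fin N) (Fin N) ℝ) (Cn : Matrix (Fin M) (Fin M) ℝ)
    (Δ : Matrix (Fin M) (Fin N) ℝ) : Fin N → ℝ :=
  (Cx * Δᵀ) *ᵥ (Cyy Cx Cn H)⁻¹ *ᵥ wVec ux un H x n + (Cx * Hᵀ) *ᵥ
    (-((Cyy Cx Cn H)⁻¹ * (Δ * Cx * Hᵀ + H * Cx * Δᵀ) * (Cyy Cx Cn H)⁻¹) *ᵥ wVec ux un H x n +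
      (Cyy Cx Cn H)⁻¹ *ᵥ Δ *ᵥ (x - ux))

theorem hasDifferentialAt_uxyP (hCx : Cx.PosSemidef) (hCn : Cn.PosDef) :
    HasDifferentialAt (fun H' => uxyP ux Cx un Cn H' x n)
      (uxyPDifferential ux un H x n Cx Cn) H := by
  have hdet := (Cyy_posDef H hCx hCn).det_pos
  have hC := hasDifferentialAt_Cyy H Cx Cn
  have hw := hasDifferentialAt_wVec ux un H x n
  have h := (HasDifferentialAt.const ux).add
    (((HasDifferentialAt.const Cx).matrix_mul HasDifferentialAt.id.transpose).mulVec
      ((hC.matrix_inv hdet.ne').mulVec hw))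
  exact h.congr_differential fun Δ => by simp [uxyPDifferential]

theorem uxyP_dotProduct_uxyPDifferential (hCx : Cx.PosSemidef) (hCn : Cn.PosDef)
    (ux₂ : Fin N → ℝ) (Cx₂ : Matrix (Fin N) (Fin N) ℝ)
    (un₂ : Fin M → ℝ) (Cn₂ : Matrix (Fin M) (Fin M) ℝ) (Δ : Matrix (Fin M) (Fin N) ℝ) :
    uxyP ux₂ Cx₂ un₂ Cn₂ H x n ⬝ᵥ uxyPDifferential ux un H x n Cx Cn Δ =
      ((Dmat ux Cx un Cn ux₂ Cx₂ un₂ Cn₂ H x n)ᵀ * Δ).trace := by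
  have hS : ((Cyy Cx Cn H)⁻¹)ᵀ = (Cyy Cx Cn H)⁻¹ := (Cyy_posDef H hCx hCn).isHermitian.inv
  have hX : Cxᵀ = Cx := hCx.isHermitian
  unfold Dmat Cmat uxyPDifferential
  generalize uxyP ux₂ Cx₂ un₂ Cn₂ H x n = v
  generalize (Cyy Cx Cn H)⁻¹ = S at *
  generalize wVec ux un H x n = w
  generalize x - ux = d
  have h1 : v ⬝ᵥ Cx *ᵥ Δᵀ *ᵥ S *ᵥ w = S *ᵥ w ⬝ᵥ Δ *ᵥ Cx *ᵥ v := by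
    have := dotProduct_transpose_mulVec (Δ * Cx) v (S *ᵥ w)
    simpa only [transpose_mul, hX, ← mulVec_mulVec] using this
  have h2 (b : Fin M → ℝ) : v ⬝ᵥ Cx *ᵥ Hᵀ *ᵥ S *ᵥ b = S *ᵥ H *ᵥ Cx *ᵥ v ⬝ᵥ b := by
    have := dotProduct_transpose_mulVec (S * H * Cx) v b
    rw [dotProduct_comm b] at this
    simpa only [transpose_mul, hX, hS, ← mulVec_mulVec] using this
  have h3 (a : Fin M → ℝ) : a ⬝ᵥ H *ᵥ Cx *ᵥ Δᵀ *ᵥ S *ᵥ w = S *ᵥ w ⬝ᵥ Δ *ᵥ Cx *ᵥ Hᵀ *ᵥ a := by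
    have := dotProduct_transpose_mulVec (Δ * Cx * Hᵀ) a (S *ᵥ w)
    simpa only [transpose_mul, hX, transpose_transpose, ← mulVec_mulVec] using this
  simp only [transpose_vecMulVec, Matrix.add_mul, vecMulVec_mul, ← mulVec_transpose, transpose_add,
    transpose_sub, trace_add, trace_sub, Matrix.sub_mul, transpose_mul, transpose_transpose, hS, hX,
    ← mulVec_mulVec, Matrix.mul_add, add_mulVec, neg_mulVec, mulVec_add, mulVec_neg,
    dotProduct_add, dotProduct_neg, h1, h2, h3, ← Matrix.mul_assoc,
    trace_vecMulVec, dotProduct_transpose_mulVec]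
  ring

end Component

section Mixture

variable {E : Type*} [NormedAddCommGroup E] [NormedSpace ℝ E] {ι o : Type*} [Fintype ι] [Fintype o]

theorem hasDifferentialAt_mixture_sq {c ρ : ι → E → ℝ} {u δ : ι → E → o → ℝ} {x : E}
    (hc : ∀ i, HasDifferentialAt (c i) (fun Δ => -(c i x * ρ i Δ)) x)
    (hu : ∀ i, HasDifferentialAt (u i) (δ i) x) (h0 : ∑ i, c i x ≠ 0) :
    HasDifferentialAt
      (fun y => ((∑ i, c i y)⁻¹ • ∑ i, c i y • u i y) ⬝ᵥ ((∑ i, c i y)⁻¹ • ∑ i, c i y • u i y))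
      (fun Δ => (∑ i, ∑ j, c i x * c j x)⁻¹ * ∑ i, ∑ j, c i x * c j x *
        (-(u i x ⬝ᵥ u j x) * (ρ i Δ + ρ j Δ) + (u j x ⬝ᵥ δ i Δ + u i x ⬝ᵥ δ j Δ) +
          2 * (u i x ⬝ᵥ u j x) / (∑ i, c i x) * ∑ i, c i x * ρ i Δ)) x := by
  have hexpand (y : E) :
      ((∑ i, c i y)⁻¹ • ∑ i, c i y • u i y) ⬝ᵥ ((∑ i, c i y)⁻¹ • ∑ i, c i y • u i y) =
        (∑ i, ∑ j, c i y * c j y * (u i y ⬝ᵥ u j y)) * ((∑ i, c i y) * ∑ i, c i y)⁻¹ := by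
    generalize ∑ i, c i y = g
    simp only [smul_dotProduct, dotProduct_smul, sum_dotProduct, dotProduct_sum, smul_eq_mul,
      Finset.mul_sum, Finset.sum_mul]
    refine Finset.sum_congr rfl fun i _ => Finset.sum_congr rfl fun j _ => ?_
    rw [dotProduct_comm (u j y)]
    ring
  simp only [hexpand]
  have hg := HasDifferentialAt.sum hc
  have hnum := HasDifferentialAt.sum fun i => HasDifferentialAt.sum fun j =>
    ((hc i).mul (hc j)).mul ((hu i).dotProduct (hu j))
  have h := hnum.mul ((hg.mul hg).comp_hasDerivAt (hasDerivAt_inv (mul_ne_zero h0 h0)))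
  refine h.congr_differential fun Δ => ?_
  have hsplit : ∑ i, ∑ j, c i x * c j x *
        (-(u i x ⬝ᵥ u j x) * (ρ i Δ + ρ j Δ) + (u j x ⬝ᵥ δ i Δ + u i x ⬝ᵥ δ j Δ) +
          2 * (u i x ⬝ᵥ u j x) / (∑ i, c i x) * ∑ i, c i x * ρ i Δ) =
      ∑ i, ∑ j, ((-(c i x * ρ i Δ) * c j x + c i x * -(c j x * ρ j Δ)) * (u i x ⬝ᵥ u j x) +
        c i x * c j x * (δ i Δ ⬝ᵥ u j x + u i x ⬝ᵥ δ j Δ)) +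
      (∑ i, ∑ j, c i x * c j x * (u i x ⬝ᵥ u j x)) *
        (2 / (∑ i, c i x) * ∑ i, c i x * ρ i Δ) := by
    simp only [Finset.sum_mul _ _ (2 / (∑ i, c i x) * ∑ i, c i x * ρ i Δ),
      ← Finset.sum_add_distrib]
    refine Finset.sum_congr rfl fun i _ => Finset.sum_congr rfl fun j _ => ?_
    rw [dotProduct_comm (δ i Δ)]
    ring
  rw [hsplit, ← Finset.sum_mul_sum, Finset.sum_neg_distrib]
  generalize ∑ i, c i x = g at *
  field_simp
  ring

end Mixture

/-- For fixed `x, n`, the map `H ↦ Ğ(H, x, n) = ‖u_{x|y}(y(H))‖₂²` is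
differentiable and its gradient equals `(∑ klrs, h^{klrs} w_{klrs}) / (∑ klrs, h^{klrs})`. -/
theorem hasGradient_Gbreve
    {M N : ℕ} {K L : Type*} [Fintype K] [Fintype L]
    (p : K → ℝ≥0) (q : L → ℝ≥0) (hp : ∑ k, p k = 1) (hq : ∑ l, q l = 1)
    (ux : K → Fin N → ℝ) (Cx : K → Matrix (Fin N) (Fin N) ℝ)
    (un : L → Fin M → ℝ) (Cn : L → Matrix (Fin M) (Fin M) ℝ)
    (hCx : ∀ k, (Cx k).PosSemidef) (hCn : ∀ l, (Cn l).PosDef)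
    (x : Fin N → ℝ) (n : Fin M → ℝ) (H : Matrix (Fin M) (Fin N) ℝ) :
    ∃ Lg : Matrix (Fin M) (Fin N) ℝ →L[ℝ] ℝ,
      HasFDerivAt (fun H' : Matrix (Fin M) (Fin N) ℝ => Gbreve p q ux Cx un Cn H' x n) Lg H ∧
      ∀ Δ : Matrix (Fin M) (Fin N) ℝ,
        Lg Δ = ((gradG p q ux Cx un Cn H x n)ᵀ * Δ).trace := by
  have hmix : 0 < ∑ i : K × L, (p i.1 : ℝ) * (q i.2 : ℝ) *
      fComp (ux i.1) (Cx i.1) (un i.2) (Cn i.2) H x n := by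
    obtain ⟨k, -, hk⟩ := Finset.exists_ne_zero_of_sum_ne_zero (hp ▸ one_ne_zero)
    obtain ⟨l, -, hl⟩ := Finset.exists_ne_zero_of_sum_ne_zero (hq ▸ one_ne_zero)
    have hf (i : K × L) := fComp_pos (ux i.1) (un i.2) H x n (hCx i.1) (hCn i.2)
    refine Finset.sum_pos' (fun i _ => by have := hf i; positivity) ⟨(k, l), Finset.mem_univ _, ?_⟩
    have hk' : (0 : ℝ) < p k := NNReal.coe_pos.2 (pos_iff_ne_zero.2 hk)
    have hl' : (0 : ℝ) < q l := NNReal.coe_pos.2 (pos_iff_ne_zero.2 hl)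
    exact mul_pos (mul_pos hk' hl') (hf (k, l))
  have h := hasDifferentialAt_mixture_sq
    (c := fun (i : K × L) H' => (p i.1 : ℝ) * (q i.2 : ℝ) *
      fComp (ux i.1) (Cx i.1) (un i.2) (Cn i.2) H' x n)
    (ρ := fun i Δ => ((Rmat (ux i.1) (Cx i.1) (un i.2) (Cn i.2) H x n)ᵀ * Δ).trace)
    (fun i => ((hasDifferentialAt_fComp (ux i.1) (un i.2) H x n (hCx i.1) (hCn i.2)).const_mul
      ((p i.1 : ℝ) * (q i.2 : ℝ))).congr_differential fun Δ => by ring)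
    (fun i => hasDifferentialAt_uxyP (ux i.1) (un i.2) H x n (hCx i.1) (hCn i.2)) hmix.ne'
  simp only [Fintype.sum_prod_type] at h
  refine HasDifferentialAt.congr_differential h fun Δ => ?_
  have hD (k k' : K) (l l' : L) := uxyP_dotProduct_uxyPDifferential (ux k) (un l) H x n
    (hCx k) (hCn l) (ux k') (Cx k') (un l') (Cn l') Δ
  have hh (k r : K) (l s : L) : (p k : ℝ) * (q l : ℝ) * fComp (ux k) (Cx k) (un l) (Cn l) H x n *
      ((p r : ℝ) * (q s : ℝ) * fComp (ux r) (Cx r) (un s) (Cn s) H x n) =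
        hCoef p q ux Cx un Cn H x n k l r s := by
    unfold hCoef
    ring
  simp only [hD, hh, gradG, wMat, zCoef, mixDen, transpose_smul, transpose_sum, transpose_add,
    Matrix.smul_mul, Matrix.sum_mul, Matrix.add_mul, trace_smul, trace_sum, trace_add, smul_eq_mul]
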